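/- In the iidpnmrv setup with E^*[|X₁|] < ∞, let a ∈ [E_*[X₁], E^*[X₁]] and let ε > 0 be such that [E_*[X₁], E^*[X₁]] is not contained in [a−ε, a+ε]. Then the inner probability of the event {ω : |Sₙ(ω)/n − a| > ε} tends to 0 as n → ∞; that is, sup{P(B) : B P-measurable, B ⊆ {ω : |Sₙ(ω)/n − a| > ε}} → 0. -/

import Mathlib

open MeasureTheory Filter Topology

/-- `flow` is a maximal measurable minorant of `f` with respect to the measure `P`. -/
def IsMeasMinorant {Ω : Type*} [MeasurableSpace Ω] (P : Measure Ω) (f flow : Ω → ℝ) : Prop :=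
  Measurable flow ∧ (∀ ω, flow ω ≤ f ω) ∧
    ∀ g : Ω → ℝ, Measurable g → (∀ ω, g ω ≤ f ω) → ∀ᵐ ω ∂P, g ω ≤ flow ω

/-- `fup` is a minimal measurable majorant of `f` with respect to the measure `P`. -/
def IsMeasMajorant {Ω : Type*} [MeasurableSpace Ω] (P : Measure Ω) (f fup : Ω → ℝ) : Prop :=
  Measurable fup ∧ (∀ ω, f ω ≤ fup ω) ∧
    ∀ h : Ω → ℝ, Measurable h → (∀ ω, f ω ≤ h ω) → ∀ᵐ ω ∂P, fup ω ≤ h ω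

/-- The set where `f` is within `δ` of its maximal measurable minorant has full outer measure. -/
theorem IsMeasMinorant.measure_le_add {Ω : Type*} [MeasurableSpace Ω] {P : Measure Ω}
    [IsProbabilityMeasure P] {f flow : Ω → ℝ} (h : IsMeasMinorant P f flow) {δ : ℝ} (hδ : 0 < δ) :
    P {x | f x ≤ flow x + δ} = 1 := by
  classical
  obtain ⟨hm, hle, hmax⟩ := h
  set M := toMeasurable P {x | f x ≤ flow x + δ} with hM
  have hMm : MeasurableSet M := measurableSet_toMeasurable _ _
  have key := hmax (fun x => flow x + Mᶜ.indicator (fun _ => δ) x)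
    (hm.add (measurable_const.indicator hMm.compl)) (fun x => by
      by_cases hx : x ∈ M
      · simpa [hx] using hle x
      · have hx' : ¬ f x ≤ flow x + δ := fun h' => hx (subset_toMeasurable _ _ h')
        simpa [hx] using (not_le.mp hx').le)
  rw [← measure_toMeasurable, ← hM, prob_compl_eq_zero_iff hMm |>.symm]
  rw [measure_eq_zero_iff_ae_notMem]
  filter_upwards [key] with x hx hx'
  rw [Set.indicator_of_mem hx'] at hx
  linarith

theorem IsMeasMajorant.neg {Ω : Type*} [MeasurableSpace Ω] {P : Measure Ω} {f fup : Ω → ℝ}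
    (h : IsMeasMajorant P f fup) : IsMeasMinorant P (fun x => -f x) (fun x => -fup x) := by
  obtain ⟨hm, hle, hmin⟩ := h
  refine ⟨hm.neg, fun x => neg_le_neg (hle x), fun g hg hgf => ?_⟩
  filter_upwards [hmin (fun x => -g x) hg.neg (fun x => by linarith [hgf x])] with x hx
  linarith

/-- The set where `f` is within `δ` of its minimal measurable majorant has full outer measure. -/
theorem IsMeasMajorant.measure_sub_le {Ω : Type*} [MeasurableSpace Ω] {P : Measure Ω}
    [IsProbabilityMeasure P] {f fup : Ω → ℝ} (h : IsMeasMajorant P f fup) {δ : ℝ} (hδ : 0 < δ) :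
    P {x | fup x - δ ≤ f x} = 1 := by
  rw [← h.neg.measure_le_add hδ]
  congr 1
  ext x
  simp only [Set.mem_ofPred_eq]
  constructor <;> intro hx <;> linarith

theorem IsMeasMinorant.integrable {Ω : Type*} [MeasurableSpace Ω] {P : Measure Ω}
    {f flow fabs : Ω → ℝ} (h : IsMeasMinorant P f flow) (habs : IsMeasMajorant P (fun x => |f x|) fabs)
    (hint : Integrable fabs P) : Integrable flow P := by
  refine hint.mono' h.1.aestronglyMeasurable ?_
  filter_upwards [h.2.2 (fun x => -fabs x) habs.1.neg
    (fun x => neg_le.mp ((neg_le_abs _).trans (habs.2.1 x)))] with x hx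
  exact abs_le.mpr ⟨hx, (h.2.1 x).trans ((le_abs_self _).trans (habs.2.1 x))⟩

theorem IsMeasMajorant.integrable {Ω : Type*} [MeasurableSpace Ω] {P : Measure Ω}
    {f fup fabs : Ω → ℝ} (h : IsMeasMajorant P f fup) (habs : IsMeasMajorant P (fun x => |f x|) fabs)
    (hint : Integrable fabs P) : Integrable fup P := by
  have := (h.neg.integrable (by simpa only [abs_neg] using habs) hint).neg
  simpa [Pi.neg_def] using this

/-- An infinite product of probability measures splits along any partition of the index set. -/
theorem infinitePi_map_piEquivPiSubtypeProd {ι : Type*} {X : ι → Type*}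
    [∀ i, MeasurableSpace (X i)] (μ : (i : ι) → Measure (X i)) [∀ i, IsProbabilityMeasure (μ i)]
    (p : ι → Prop) [DecidablePred p] :
    (Measure.infinitePi μ).map (MeasurableEquiv.piEquivPiSubtypeProd X p) =
      (Measure.infinitePi fun i : {i // p i} => μ i).prod
        (Measure.infinitePi fun i : {i // ¬ p i} => μ i) := by
  rw [MeasurableEquiv.map_apply_eq_iff_map_symm_apply_eq]
  refine (Measure.eq_infinitePi μ fun s t ht => ?_).symm
  rw [MeasurableEquiv.map_apply]
  have hpre : (MeasurableEquiv.piEquivPiSubtypeProd X p).symm ⁻¹' (Set.pi s t) =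
      (Set.pi (s.subtype p) fun i : {i // p i} => t i) ×ˢ
        (Set.pi (s.subtype fun i => ¬ p i) fun i : {i // ¬ p i} => t i) := by
    ext q
    simp only [MeasurableEquiv.piEquivPiSubtypeProd, Set.mem_preimage, Set.mem_pi, Set.mem_prod, Finset.mem_coe,
      Finset.mem_subtype, Subtype.forall]
    constructor
    · intro h
      exact ⟨fun i hi his => by simpa [hi] using h i his, fun i hi his => by simpa [hi] using h i his⟩
    · rintro ⟨h1, h2⟩ i his
      by_cases hi : p i
      · simpa [hi] using h1 i hi his
      · simpa [hi] using h2 i hi his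
  rw [hpre, Measure.prod_prod, Measure.infinitePi_pi _ (fun i _ => ht i.1),
    Measure.infinitePi_pi _ (fun i _ => ht i.1),
    Finset.prod_subtype_eq_prod_filter (fun i => μ i (t i)),
    Finset.prod_subtype_eq_prod_filter (fun i => μ i (t i)), Finset.prod_filter_mul_prod_filter_not]

/-- The formula for the measure of a finite box holds without measurability of its sides. -/
theorem infinitePi_pi_finset {ι : Type*} {X : ι → Type*}
    [∀ i, MeasurableSpace (X i)] (μ : (i : ι) → Measure (X i)) [∀ i, IsProbabilityMeasure (μ i)]
    (s : Finset ι) (t : (i : ι) → Set (X i)) :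
    Measure.infinitePi μ (Set.pi s t) = ∏ i ∈ s, μ i (t i) := by
  classical
  have hpre : (MeasurableEquiv.piEquivPiSubtypeProd X (· ∈ s)) ⁻¹'
      ((Set.pi Set.univ fun i : {i // i ∈ s} => t i) ×ˢ Set.univ) = Set.pi s t := by
    ext ω
    simp [MeasurableEquiv.piEquivPiSubtypeProd, Set.mem_pi]
  rw [← hpre, ← MeasurableEquiv.map_apply, infinitePi_map_piEquivPiSubtypeProd,
    Measure.prod_prod, measure_univ, mul_one, Measure.infinitePi_eq_pi, Measure.pi_pi]
  exact Finset.prod_coe_sort s (fun i => μ i (t i))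

/-- The strong law of large numbers for i.i.d. coordinates of an infinite product. -/
theorem infinitePi_strong_law {Ω₁ : Type*} [MeasurableSpace Ω₁] (P₁ : Measure Ω₁)
    [IsProbabilityMeasure P₁] {f : Ω₁ → ℝ} (hf : Measurable f) (hint : Integrable f P₁) :
    ∀ᵐ ω ∂(Measure.infinitePi fun _ : ℕ => P₁),
      Tendsto (fun n : ℕ => (∑ i ∈ Finset.range n, f (ω i)) / n) atTop (𝓝 (∫ x, f x ∂P₁)) := by
  have hmp (i : ℕ) : MeasurePreserving (fun ω : ℕ → Ω₁ => ω i)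
      (Measure.infinitePi fun _ : ℕ => P₁) P₁ :=
    measurePreserving_eval_infinitePi (fun _ : ℕ => P₁) i
  have hind := ProbabilityTheory.iIndepFun_infinitePi (P := fun _ : ℕ => P₁)
    (X := fun _ => f) (fun _ => hf)
  have := ProbabilityTheory.strong_law_ae_real (μ := Measure.infinitePi fun _ : ℕ => P₁)
    (fun i ω => f (ω i)) ((hmp 0).integrable_comp_of_integrable hint)
    (fun i j hij => hind.indepFun hij)
    (fun i => ⟨(hf.comp (hmp i).measurable).aemeasurable, (hf.comp (hmp 0).measurable).aemeasurable,
      by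
        have h (k : ℕ) : Measure.map (fun ω : ℕ → Ω₁ => f (ω k))
            (Measure.infinitePi fun _ : ℕ => P₁) = P₁.map f := by
          conv_rhs => rw [← (hmp k).map_eq, Measure.map_map hf (hmp k).measurable]
          rfl
        rw [h, h]⟩)
  have hmean : ∫ ω, f (ω 0) ∂(Measure.infinitePi fun _ : ℕ => P₁) = ∫ x, f x ∂P₁ := by
    conv_rhs => rw [← (hmp 0).map_eq]
    rw [integral_map (hmp 0).measurable.aemeasurable hf.aestronglyMeasurable]
  rwa [hmean] at this

/-- Averages along a subsequence of proportion `p`, normalised by the full length. -/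
theorem tendsto_floor_average {u : ℕ → ℝ} {m p : ℝ} (h0 : u 0 = 0)
    (hu : Tendsto (fun n : ℕ => u n / n) atTop (𝓝 m)) (hp : 0 ≤ p) :
    Tendsto (fun n : ℕ => u ⌊p * n⌋₊ / n) atTop (𝓝 (p * m)) := by
  rcases hp.eq_or_lt with rfl | hp
  · simp [h0]
  have hk : Tendsto (fun n : ℕ => ⌊p * (n : ℝ)⌋₊) atTop atTop :=
    tendsto_nat_floor_atTop.comp (tendsto_natCast_atTop_atTop.const_mul_atTop hp)
  have hr : Tendsto (fun n : ℕ => (⌊p * (n : ℝ)⌋₊ : ℝ) / n) atTop (𝓝 p) :=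
    (tendsto_nat_floor_mul_div_atTop hp.le).comp tendsto_natCast_atTop_atTop
  refine (hr.mul (hu.comp hk)).congr' ?_
  filter_upwards [hk.eventually_gt_atTop 0] with n hn
  have : (⌊p * (n : ℝ)⌋₊ : ℝ) ≠ 0 := by exact_mod_cast hn.ne'
  simp only [Function.comp]
  field_simp

/-- A measurable event on which the averages of `f` are far from `a` is no more likely than the
averages of a measurable selection `c` being far from `a`, provided each `c i` is close to `f` on a
set of full outer measure. -/
theorem measure_le_measure_average_selection {Ω₁ : Type*} [MeasurableSpace Ω₁] (P₁ : Measure Ω₁)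
    [IsProbabilityMeasure P₁] {f : Ω₁ → ℝ} {c : ℕ → Ω₁ → ℝ} {δ : ℝ}
    (hc : ∀ i, Measurable (c i)) (hfc : ∀ i, P₁ {x | |f x - c i x| ≤ δ} = 1) (n : ℕ) (a ε : ℝ)
    (hδ : 0 ≤ δ) {B : Set (ℕ → Ω₁)} (hB : MeasurableSet B)
    (hBsub : B ⊆ {ω | ε < |(∑ i ∈ Finset.range n, f (ω i)) / n - a|}) :
    Measure.infinitePi (fun _ : ℕ => P₁) B ≤ Measure.infinitePi (fun _ : ℕ => P₁)
      {ω | ε - δ ≤ |(∑ i ∈ Finset.range n, c i (ω i)) / n - a|} := by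
  set G : Set (ℕ → Ω₁) := {ω | ε - δ ≤ |(∑ i ∈ Finset.range n, c i (ω i)) / n - a|} with hG
  have hGm : MeasurableSet G := by
    refine measurableSet_le measurable_const (Measurable.abs ?_)
    refine Measurable.sub_const (Measurable.div_const ?_ _) _
    exact Finset.measurable_fun_sum _ fun i _ => (hc i).comp (measurable_pi_apply i)
  set C : Set (ℕ → Ω₁) := Set.pi (Finset.range n) fun i => {x | |f x - c i x| ≤ δ} with hC
  have hC1 : Measure.infinitePi (fun _ : ℕ => P₁) C = 1 := by
    rw [hC, infinitePi_pi_finset]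
    exact Finset.prod_eq_one fun i _ => hfc i
  have hCsub : C ⊆ (B \ G)ᶜ := by
    rintro ω hω ⟨hωB, hωG⟩
    have h1 : ε < |(∑ i ∈ Finset.range n, f (ω i)) / n - a| := hBsub hωB
    have h2 : |(∑ i ∈ Finset.range n, c i (ω i)) / n - a| < ε - δ := not_le.mp hωG
    have h3 : |∑ i ∈ Finset.range n, (f (ω i) - c i (ω i))| ≤ n * δ := by
      refine (Finset.abs_sum_le_sum_abs _ _).trans ?_
      simpa using Finset.sum_le_card_nsmul (Finset.range n) _ δ fun i hi => hω i hi
    have h4 : |(∑ i ∈ Finset.range n, f (ω i)) / n - (∑ i ∈ Finset.range n, c i (ω i)) / n| ≤ δ := by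
      rw [← sub_div, ← Finset.sum_sub_distrib, abs_div, Nat.abs_cast]
      exact div_le_of_le_mul₀ (Nat.cast_nonneg n) hδ (by linarith)
    have h5 := abs_sub_le ((∑ i ∈ Finset.range n, f (ω i)) / n)
      ((∑ i ∈ Finset.range n, c i (ω i)) / n) a
    linarith
  have h0 : Measure.infinitePi (fun _ : ℕ => P₁) (B \ G) = 0 := by
    rw [← prob_compl_eq_one_iff (hB.diff hGm)]
    exact le_antisymm prob_le_one (hC1 ▸ measure_mono hCsub)
  exact measure_mono_ae (ae_le_set.mpr h0)

/-- Strong law for averages of `f` over the first `⌊p n⌋` coordinates and `g` over the rest. -/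
theorem infinitePi_strong_law_mixture {Ω₁ : Type*} [MeasurableSpace Ω₁] (P₁ : Measure Ω₁)
    [IsProbabilityMeasure P₁] {f g : Ω₁ → ℝ} (hf : Measurable f) (hg : Measurable g)
    (hfi : Integrable f P₁) (hgi : Integrable g P₁) {p : ℝ} (hp0 : 0 ≤ p) (hp1 : p ≤ 1) :
    ∀ᵐ ω ∂(Measure.infinitePi fun _ : ℕ => P₁),
      Tendsto (fun n : ℕ => (∑ i ∈ Finset.range n,
          (if i < ⌊p * n⌋₊ then f else g) (ω i)) / n) atTop
        (𝓝 (p * (∫ x, f x ∂P₁) + (1 - p) * ∫ x, g x ∂P₁)) := by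
  filter_upwards [infinitePi_strong_law P₁ hf hfi, infinitePi_strong_law P₁ hg hgi] with ω h1 h2
  have h3 := ((tendsto_floor_average (u := fun n => ∑ i ∈ Finset.range n, f (ω i)) (by simp) h1
    hp0).add h2).sub (tendsto_floor_average (u := fun n => ∑ i ∈ Finset.range n, g (ω i)) (by simp)
    h2 hp0)
  convert h3 using 2 with n
  · have hk : ⌊p * (n : ℝ)⌋₊ ≤ n :=
      Nat.floor_le_of_le (mul_le_of_le_one_left (Nat.cast_nonneg n) hp1)
    rw [← add_div, ← sub_div, ← Finset.sum_range_add_sum_Ico _ hk,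
      ← Finset.sum_range_add_sum_Ico (fun i => g (ω i)) hk,
      Finset.sum_congr rfl fun i hi => by rw [if_pos (Finset.mem_range.mp hi)],
      Finset.sum_congr (s₁ := Finset.Ico _ _) rfl fun i hi => by
        rw [if_neg (Finset.mem_Ico.mp hi).1.not_gt]]
    ring
  · ring

/-- In the iidpnmrv setup with integrable minimal measurable majorant of `|Ψ|`, if `a ∈ [E_*[X₁], E^*[X₁]]` and `ε > 0` is small enough that `[E_*[X₁], E^*[X₁]] ⊄ [a-ε, a+ε]`, then the inner probability of `{|Sₙ/n − a| > ε}` tends to `0`. -/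
theorem weak_law_inner_probability_tendsto_zero
    {Ω₁ : Type*} [MeasurableSpace Ω₁] (P₁ : Measure Ω₁) [IsProbabilityMeasure P₁]
    (P : Measure (ℕ → Ω₁)) [IsProbabilityMeasure P]
    (hP : IsProjectiveLimit P (fun J : Finset ℕ => Measure.pi (fun _ : J => P₁)))
    (Ψ Ψlow Ψup Ψabs : Ω₁ → ℝ)
    (hΨlow : IsMeasMinorant P₁ Ψ Ψlow)
    (hΨup : IsMeasMajorant P₁ Ψ Ψup)
    (hΨabs : IsMeasMajorant P₁ (fun x => |Ψ x|) Ψabs)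
    (hInt : Integrable Ψabs P₁)
    (a ε : ℝ) (hε : 0 < ε)
    (ha : a ∈ Set.Icc (∫ x, Ψlow x ∂P₁) (∫ x, Ψup x ∂P₁))
    (hnotsub : ¬ Set.Icc (∫ x, Ψlow x ∂P₁) (∫ x, Ψup x ∂P₁) ⊆ Set.Icc (a - ε) (a + ε)) :
    Tendsto (fun n : ℕ =>
        ⨆ (B : Set (ℕ → Ω₁)) (_ : MeasurableSet B ∧
          B ⊆ {ω : ℕ → Ω₁ | ε < |(∑ i ∈ Finset.range n, Ψ (ω i)) / n - a|}), P B)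
      atTop (𝓝 0) := by
  obtain rfl : P = Measure.infinitePi fun _ : ℕ => P₁ :=
    hP.unique (Measure.isProjectiveLimit_infinitePi fun _ : ℕ => P₁)
  have hmeas (k i : ℕ) : Measurable (if i < k then Ψlow else Ψup) := by
    split_ifs
    exacts [hΨlow.1, hΨup.1]
  obtain ⟨p, q, hp, hq, hpq, hpa⟩ :
      ∃ p q : ℝ, 0 ≤ p ∧ 0 ≤ q ∧ p + q = 1 ∧
        p • (∫ x, Ψlow x ∂P₁) + q • (∫ x, Ψup x ∂P₁) = a := by
    rw [← segment_eq_Icc (ha.1.trans ha.2)] at ha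
    exact ha
  obtain rfl : q = 1 - p := by linarith
  have hlaw := infinitePi_strong_law_mixture P₁ hΨlow.1 hΨup.1 (hΨlow.integrable hΨabs hInt)
    (hΨup.integrable hΨabs hInt) hp (by linarith : p ≤ 1)
  simp only [smul_eq_mul] at hpa
  rw [hpa] at hlaw
  have hmes := tendstoInMeasure_iff_norm.mp (tendstoInMeasure_of_tendsto_ae (fun n =>
    Measurable.aestronglyMeasurable <| Measurable.div_const
      (Finset.measurable_fun_sum _ fun i _ => (hmeas _ i).comp (measurable_pi_apply i)) _) hlaw)
    (ε / 2) (half_pos hε)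
  refine tendsto_of_tendsto_of_tendsto_of_le_of_le tendsto_const_nhds hmes
    (fun n => zero_le) fun n => ?_
  refine iSup₂_le fun B hB => ?_
  have h := measure_le_measure_average_selection P₁ (hmeas ⌊p * n⌋₊) (δ := ε / 2) (f := Ψ)
    (fun i => ?_) n a ε (half_pos hε).le hB.1 hB.2
  · rwa [sub_half] at h
  · split_ifs
    · rw [← hΨlow.measure_le_add (half_pos hε)]
      congr 1
      ext x
      have := hΨlow.2.1 x
      simp only [Set.mem_ofPred_eq, abs_le]
      exact ⟨fun h => by linarith [h.2], fun h => ⟨by linarith, by linarith⟩⟩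
    · rw [← hΨup.measure_sub_le (half_pos hε)]
      congr 1
      ext x
      have := hΨup.2.1 x
      simp only [Set.mem_ofPred_eq, abs_le]
      exact ⟨fun h => by linarith [h.1], fun h => ⟨by linarith, by linarith⟩⟩
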